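/- Let S be an inverse semigroup and let R be an S-graded ring. The following are equivalent: (i) R is graded von Neumann regular; (ii) for all s ∈ S and r ∈ R_s, there exist t ∈ V(s) and y ∈ R_t such that r = ryr; (iii) R is nearly epsilon-strongly S-graded and R_e is a von Neumann regular ring for every e ∈ E(S). -/

import Mathlib

open scoped Pointwise

/-- The set `E(S)` of idempotent elements of a semigroup `S`. -/
def idempotentSet (S : Type*) [Semigroup S] : Set S := {s | s * s = s}

/-- The set `V(s) = {t ∈ S ∣ sts = s and tst = t}`. -/
def invSet {S : Type*} [Semigroup S] (s : S) : Set S :=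
  {t | s * t * s = s ∧ t * s * t = t}

/-- The product `A B` of two additive subgroups of a ring: the additive subgroup
generated by all products `a * b` with `a ∈ A`, `b ∈ B`. -/
def subgroupMul {R : Type*} [NonUnitalRing R] (A B : AddSubgroup R) : AddSubgroup R :=
  AddSubgroup.closure ((A : Set R) * (B : Set R))

/-- `R` is an `S`-graded ring via the family `𝒜` of additive subgroups:
`R = ⊕_{s ∈ S} R_s` (internal direct sum) and `R_s R_t ⊆ R_{st}`. -/
structure IsSemigroupGrading {S R : Type*} [Semigroup S] [DecidableEq S] [NonUnitalRing R]
    (𝒜 : S → AddSubgroup R) : Prop where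
  internal : DirectSum.IsInternal 𝒜
  mul_mem : ∀ s t : S, ∀ a ∈ 𝒜 s, ∀ b ∈ 𝒜 t, a * b ∈ 𝒜 (s * t)

/-- `R` is symmetrically `S`-graded: `R_s = R_s R_t R_s` for all `s ∈ S`, `t ∈ V(s)`. -/
def SymmetricallyGraded {S R : Type*} [Semigroup S] [NonUnitalRing R]
    (𝒜 : S → AddSubgroup R) : Prop :=
  ∀ s : S, ∀ t ∈ invSet s, 𝒜 s = subgroupMul (subgroupMul (𝒜 s) (𝒜 t)) (𝒜 s)

/-- A subset `P` of `R` (closed under multiplication) is a unital ring: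
it has a two-sided multiplicative identity element. -/
def HasUnity {R : Type*} [NonUnitalRing R] (P : AddSubgroup R) : Prop :=
  ∃ u ∈ P, ∀ x ∈ P, u * x = x ∧ x * u = x

/-- A subset `P` of `R` is an s-unital ring: `x ∈ Px` and `x ∈ xP` for every `x ∈ P`. -/
def IsSUnital {R : Type*} [NonUnitalRing R] (P : AddSubgroup R) : Prop :=
  ∀ x ∈ P, (∃ u ∈ P, u * x = x) ∧ (∃ v ∈ P, x * v = x)

/-- A subset `P` of `R` is a von Neumann regular ring: `r ∈ rPr` for every `r ∈ P`. -/
def IsVonNeumannRegular {R : Type*} [NonUnitalRing R] (P : AddSubgroup R) : Prop :=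
  ∀ r ∈ P, ∃ x ∈ P, r = r * x * r

/-- `R` is epsilon-strongly `S`-graded. -/
def EpsilonStronglyGraded {S R : Type*} [Semigroup S] [NonUnitalRing R]
    (𝒜 : S → AddSubgroup R) : Prop :=
  SymmetricallyGraded 𝒜 ∧ ∀ s : S, ∀ t ∈ invSet s, HasUnity (subgroupMul (𝒜 s) (𝒜 t))

/-- `R` is nearly epsilon-strongly `S`-graded. -/
def NearlyEpsilonStronglyGraded {S R : Type*} [Semigroup S] [NonUnitalRing R]
    (𝒜 : S → AddSubgroup R) : Prop :=
  SymmetricallyGraded 𝒜 ∧ ∀ s : S, ∀ t ∈ invSet s, IsSUnital (subgroupMul (𝒜 s) (𝒜 t))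

/-- `R` is strongly `S`-graded: `R_s R_t = R_{st}` for all `s, t ∈ S`. -/
def StronglyGraded {S R : Type*} [Semigroup S] [NonUnitalRing R]
    (𝒜 : S → AddSubgroup R) : Prop :=
  ∀ s t : S, subgroupMul (𝒜 s) (𝒜 t) = 𝒜 (s * t)

/-- `R` is graded von Neumann regular: for all `s ∈ S`, `r ∈ R_s` and `t ∈ V(s)`,
there is `y ∈ R_t` with `r = ryr`. -/
def GradedVonNeumannRegular {S R : Type*} [Semigroup S] [NonUnitalRing R]
    (𝒜 : S → AddSubgroup R) : Prop :=
  ∀ s : S, ∀ r ∈ 𝒜 s, ∀ t ∈ invSet s, ∃ y ∈ 𝒜 t, r = r * y * r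

section subgroupMul

variable {R : Type*} [NonUnitalRing R] {A B C : AddSubgroup R}

theorem mul_mem_subgroupMul {a b : R} (ha : a ∈ A) (hb : b ∈ B) : a * b ∈ subgroupMul A B :=
  AddSubgroup.subset_closure (Set.mul_mem_mul ha hb)

/-- Induction principle for membership in a product of additive subgroups. -/
theorem subgroupMul_induction {p : R → Prop} (mul : ∀ a ∈ A, ∀ b ∈ B, p (a * b)) (zero : p 0)
    (add : ∀ x y, p x → p y → p (x + y)) (neg : ∀ x, p x → p (-x)) {x : R}
    (hx : x ∈ subgroupMul A B) : p x := by
  refine AddSubgroup.closure_induction (p := fun x _ => p x) ?_ zero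
    (fun x y _ _ => add x y) (fun x _ => neg x) hx
  rintro _ ⟨a, ha, b, hb, rfl⟩
  exact mul a ha b hb

theorem subgroupMul_le (h : ∀ a ∈ A, ∀ b ∈ B, a * b ∈ C) : subgroupMul A B ≤ C := fun _ hx =>
  subgroupMul_induction (p := (· ∈ C)) h C.zero_mem (fun _ _ => C.add_mem)
    (fun _ => C.neg_mem) hx

theorem mul_mem_subgroupMul_of_left {u x : R} (hu : ∀ a ∈ A, u * a ∈ A)
    (hx : x ∈ subgroupMul A B) : u * x ∈ subgroupMul A B := by
  refine subgroupMul_induction (p := fun x => u * x ∈ subgroupMul A B)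
    (fun a ha b hb => ?_) ?_ (fun x y hx hy => ?_) (fun x hx => ?_) hx
  · rw [← mul_assoc]
    exact mul_mem_subgroupMul (hu a ha) hb
  · rw [mul_zero]
    exact zero_mem _
  · rw [mul_add]
    exact add_mem hx hy
  · rw [mul_neg]
    exact neg_mem hx

theorem mul_mem_subgroupMul_of_right {u x : R} (hu : ∀ b ∈ B, b * u ∈ B)
    (hx : x ∈ subgroupMul A B) : x * u ∈ subgroupMul A B := by
  refine subgroupMul_induction (p := fun x => x * u ∈ subgroupMul A B)
    (fun a ha b hb => ?_) ?_ (fun x y hx hy => ?_) (fun x hx => ?_) hx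
  · rw [mul_assoc]
    exact mul_mem_subgroupMul ha (hu b hb)
  · rw [zero_mul]
    exact zero_mem _
  · rw [add_mul]
    exact add_mem hx hy
  · rw [neg_mul]
    exact neg_mem hx

end subgroupMul

theorem invSet_symm {S : Type*} [Semigroup S] {s t : S} (h : t ∈ invSet s) : s ∈ invSet t :=
  ⟨h.2, h.1⟩

theorem self_mem_invSet {S : Type*} [Semigroup S] {e : S} (he : e ∈ idempotentSet S) :
    e ∈ invSet e := by
  have he : e * e = e := he
  constructor <;> rw [he, he]

theorem mul_mem_idempotentSet {S : Type*} [Semigroup S] {s t : S} (h : t ∈ invSet s) :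
    s * t ∈ idempotentSet S := by
  change s * t * (s * t) = s * t
  rw [← mul_assoc, h.1]

section graded

variable {S R : Type*} [Semigroup S] [DecidableEq S] [NonUnitalRing R] {𝒜 : S → AddSubgroup R}

theorem IsSemigroupGrading.mul_mem_of_eq (hgr : IsSemigroupGrading 𝒜) {s t w : S} {a b : R}
    (ha : a ∈ 𝒜 s) (hb : b ∈ 𝒜 t) (h : s * t = w) : a * b ∈ 𝒜 w :=
  h ▸ hgr.mul_mem s t a ha b hb

theorem GradedVonNeumannRegular.symmetricallyGraded (hgr : IsSemigroupGrading 𝒜)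
    (h : GradedVonNeumannRegular 𝒜) : SymmetricallyGraded 𝒜 := by
  intro s t ht
  apply le_antisymm
  · intro r hr
    obtain ⟨y, hy, hry⟩ := h s r hr t ht
    rw [hry]
    exact mul_mem_subgroupMul (mul_mem_subgroupMul hr hy) hr
  · refine subgroupMul_le fun a ha b hb => ?_
    exact hgr.mul_mem_of_eq (subgroupMul_le (hgr.mul_mem s t) ha) hb ht.1

theorem GradedVonNeumannRegular.isSUnital (hgr : IsSemigroupGrading 𝒜)
    (h : GradedVonNeumannRegular 𝒜) {s t : S} (ht : t ∈ invSet s) :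
    IsSUnital (subgroupMul (𝒜 s) (𝒜 t)) := by
  intro x hx
  obtain ⟨y, hy, hxy⟩ := h (s * t) x (subgroupMul_le (hgr.mul_mem s t) hx) (s * t)
    (self_mem_invSet (mul_mem_idempotentSet ht))
  refine ⟨⟨x * y, ?_, hxy.symm⟩, ⟨y * x, ?_, by rw [← mul_assoc, ← hxy]⟩⟩
  · exact mul_mem_subgroupMul_of_right
      (fun b hb => hgr.mul_mem_of_eq hb hy (by rw [← mul_assoc, ht.2])) hx
  · exact mul_mem_subgroupMul_of_left (fun a ha => hgr.mul_mem_of_eq hy ha ht.1) hx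

/-- Every homogeneous element of a nearly epsilon-strongly graded ring has a right unit in
`R_t R_s`. -/
theorem NearlyEpsilonStronglyGraded.exists_mul_eq_self (hgr : IsSemigroupGrading 𝒜)
    (h : NearlyEpsilonStronglyGraded 𝒜) {s t : S} (ht : t ∈ invSet s) {r : R} (hr : r ∈ 𝒜 s) :
    ∃ u ∈ subgroupMul (𝒜 t) (𝒜 s), r * u = r := by
  let Q := subgroupMul (𝒜 t) (𝒜 s)
  have hQ : Q ≤ 𝒜 (t * s) := subgroupMul_le (hgr.mul_mem t s)
  have mul_mem_Q : ∀ x ∈ Q, ∀ y ∈ Q, x * y ∈ Q := fun x hx y hy =>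
    mul_mem_subgroupMul_of_left (fun a ha => hgr.mul_mem_of_eq (hQ hx) ha ht.2) hy
  -- Any right unit `u ∈ Q` can be enlarged to one that also works for a given element.
  let p : R → Prop := fun x =>
    ∀ u ∈ Q, ∃ u' ∈ Q, (∀ w, w * u = w → w * u' = w) ∧ x * u' = x
  have p_zero : p 0 := fun u hu => ⟨u, hu, fun _ hw => hw, zero_mul u⟩
  have p_neg : ∀ x, p x → p (-x) := by
    intro x hx u hu
    obtain ⟨u', hu', hw, hx'⟩ := hx u hu
    exact ⟨u', hu', hw, by rw [neg_mul, hx']⟩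
  have p_add : ∀ x y, p x → p y → p (x + y) := by
    intro x y hx hy u hu
    obtain ⟨u₁, hu₁, hw₁, hx₁⟩ := hx u hu
    obtain ⟨u₂, hu₂, hw₂, hy₂⟩ := hy u₁ hu₁
    exact ⟨u₂, hu₂, fun w hw => hw₂ w (hw₁ w hw), by rw [add_mul, hw₂ x hx₁, hy₂]⟩
  have p_mul : ∀ a, ∀ x ∈ Q, p (a * x) := by
    intro a x hx u hu
    obtain ⟨v, hv, hxv⟩ := (h.2 t s (invSet_symm ht) (x - x * u)
      (sub_mem hx (mul_mem_Q x hx u hu))).2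
    refine ⟨u + v - u * v, sub_mem (add_mem hu hv) (mul_mem_Q u hu v hv), fun w hw => ?_, ?_⟩
    · rw [mul_sub, mul_add, ← mul_assoc, hw, add_sub_cancel_right]
    · rw [mul_assoc]
      congr 1
      calc x * (u + v - u * v) = x * u + (x - x * u) * v := by noncomm_ring
        _ = x := by rw [hxv]; abel
  have hp : p r := by
    rw [h.1 s t ht] at hr
    refine subgroupMul_induction (fun a ha c hc => ?_) p_zero p_add p_neg hr
    refine subgroupMul_induction (p := fun a => p (a * c)) (fun a _ b hb => ?_) ?_
      (fun x y hx hy => ?_) (fun x hx => ?_) ha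
    · rw [mul_assoc]
      exact p_mul a _ (mul_mem_subgroupMul hb hc)
    · rw [zero_mul]
      exact p_zero
    · rw [add_mul]
      exact p_add _ _ hx hy
    · rw [neg_mul]
      exact p_neg _ hx
  obtain ⟨u, hu, -, hru⟩ := hp 0 (zero_mem _)
  exact ⟨u, hu, hru⟩

/-- If `R_{st}` is von Neumann regular and `r ∈ R_s`, then every `v ∈ R_t R_s` satisfies
`r v ∈ r R_t r v`. -/
theorem IsVonNeumannRegular.exists_mul_mul_eq (hgr : IsSemigroupGrading 𝒜) {s t : S}
    (ht : t ∈ invSet s) (h : IsVonNeumannRegular (𝒜 (s * t))) {r v : R} (hr : r ∈ 𝒜 s)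
    (hv : v ∈ subgroupMul (𝒜 t) (𝒜 s)) : ∃ y ∈ 𝒜 t, r * y * (r * v) = r * v := by
  suffices H : ∀ y ∈ 𝒜 t, ∃ y' ∈ 𝒜 t,
      (∀ w, r * y * (r * w) = r * w → r * y' * (r * w) = r * w) ∧ r * y' * (r * v) = r * v by
    obtain ⟨y, hy, -, hyv⟩ := H 0 (zero_mem _)
    exact ⟨y, hy, hyv⟩
  refine subgroupMul_induction (p := fun v => ∀ y ∈ 𝒜 t, ∃ y' ∈ 𝒜 t,
      (∀ w, r * y * (r * w) = r * w → r * y' * (r * w) = r * w) ∧ r * y' * (r * v) = r * v)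
    ?_ ?_ ?_ ?_ hv
  · intro b hb c _ y hy
    have hd : b - y * (r * b) ∈ 𝒜 t :=
      sub_mem hb (hgr.mul_mem_of_eq hy (hgr.mul_mem s t r hr b hb) (by rw [← mul_assoc, ht.2]))
    obtain ⟨x, hx, hdx⟩ := h _ (hgr.mul_mem s t r hr _ hd)
    set d := b - y * (r * b) with hd_def
    have hz : d * x ∈ 𝒜 t := hgr.mul_mem_of_eq hd hx (by rw [← mul_assoc, ht.2])
    have key : ∀ w, r * (y + d * x - d * x * (r * y)) * (r * w) =
        r * y * (r * w) + r * d * x * (r * w - r * y * (r * w)) := fun w => by noncomm_ring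
    refine ⟨y + d * x - d * x * (r * y), sub_mem (add_mem hy hz)
      (hgr.mul_mem_of_eq hz (hgr.mul_mem s t r hr y hy) (by rw [← mul_assoc, ht.2])),
      fun w hw => ?_, ?_⟩
    · rw [key, hw, sub_self, mul_zero, add_zero]
    · have hrd : r * (b * c) - r * y * (r * (b * c)) = r * d * c := by
        rw [hd_def]; noncomm_ring
      rw [key, hrd, ← mul_assoc (r * d * x), ← hdx, ← hrd]
      abel
  · exact fun y hy => ⟨y, hy, fun _ hw => hw, by simp⟩
  · intro v₁ v₂ h₁ h₂ y hy
    obtain ⟨y₁, hy₁, hw₁, hv₁⟩ := h₁ y hy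
    obtain ⟨y₂, hy₂, hw₂, hv₂⟩ := h₂ y₁ hy₁
    refine ⟨y₂, hy₂, fun w hw => hw₂ w (hw₁ w hw), ?_⟩
    rw [mul_add, mul_add, hw₂ v₁ hv₁, hv₂]
  · intro v hv y hy
    obtain ⟨y', hy', hw', hvy⟩ := hv y hy
    exact ⟨y', hy', hw', by rw [mul_neg, mul_neg, hvy]⟩

/-- For a grading by an arbitrary semigroup, graded von Neumann regularity amounts to nearly
epsilon-strong gradedness together with von Neumann regularity of the idempotent components. -/
theorem gradedVonNeumannRegular_iff_nearlyEpsilonStronglyGraded (hgr : IsSemigroupGrading 𝒜) :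
    GradedVonNeumannRegular 𝒜 ↔
      NearlyEpsilonStronglyGraded 𝒜 ∧ ∀ e ∈ idempotentSet S, IsVonNeumannRegular (𝒜 e) := by
  constructor
  · exact fun h => ⟨⟨h.symmetricallyGraded hgr, fun s t ht => h.isSUnital hgr ht⟩,
      fun e he r hr => h e r hr e (self_mem_invSet he)⟩
  · rintro ⟨hne, hreg⟩ s r hr t ht
    obtain ⟨v, hv, hrv⟩ := hne.exists_mul_eq_self hgr ht hr
    obtain ⟨y, hy, hyv⟩ :=
      (hreg _ (mul_mem_idempotentSet ht)).exists_mul_mul_eq hgr ht hr hv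
    rw [hrv] at hyv
    exact ⟨y, hy, hyv.symm⟩

end graded

/-- **Theorem (inverse semigroups).** Let `S` be an inverse semigroup (every `s ∈ S` has
exactly one element in `V(s)`) and let `R` be an `S`-graded ring. The following are
equivalent: (i) `R` is graded von Neumann regular; (ii) for all `s ∈ S` and `r ∈ R_s`,
there exist `t ∈ V(s)` and `y ∈ R_t` with `r = ryr`; (iii) `R` is nearly epsilon-strongly
`S`-graded and `R_e` is von Neumann regular for every `e ∈ E(S)`. -/
theorem gradedVonNeumannRegular_tfae_of_inverseSemigroup
    {S R : Type*} [Semigroup S] [DecidableEq S] [NonUnitalRing R]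
    (hinv : ∀ s : S, ∃! t : S, t ∈ invSet s)
    (𝒜 : S → AddSubgroup R) (hgr : IsSemigroupGrading 𝒜) :
    (GradedVonNeumannRegular 𝒜 ↔
      ∀ s : S, ∀ r ∈ 𝒜 s, ∃ t ∈ invSet s, ∃ y ∈ 𝒜 t, r = r * y * r) ∧
    (GradedVonNeumannRegular 𝒜 ↔
      NearlyEpsilonStronglyGraded 𝒜 ∧ ∀ e ∈ idempotentSet S, IsVonNeumannRegular (𝒜 e)) := by
  refine ⟨⟨fun h s r hr => ?_, fun h s r hr t ht => ?_⟩,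
    gradedVonNeumannRegular_iff_nearlyEpsilonStronglyGraded hgr⟩
  · obtain ⟨t, ht, -⟩ := hinv s
    exact ⟨t, ht, h s r hr t ht⟩
  · obtain ⟨t', ht', hy⟩ := h s r hr
    exact (hinv s).unique ht' ht ▸ hy
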